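/- Let (G,u) be a maximum flow instance and let f be an extreme point of the flow polyhedron FlowP(G,u) whose support contains no directed cycle. Then for every arc e ∈ E there exists χ : E → {−1,0,1} with χ_{e'} = 0 whenever u_{e'} = ∞, such that f_e = Σ_{e' ∈ E with u_{e'} < ∞} χ_{e'} · u_{e'}. -/

import Mathlib

open scoped ENNReal Classical

noncomputable section

/-- A maximum flow instance: a finite directed graph (parallel arcs allowed, no
self-loops) with distinct source `s` and sink `t`, a fixed-point-free reversal
involution on arcs, and capacities in `[0,∞]`. -/
structure FlowInstance (V E : Type) [Fintype V] [Fintype E] [DecidableEq V] where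
  tail : E → V
  head : E → V
  s : V
  t : V
  s_ne_t : s ≠ t
  rev : E → E
  rev_rev : ∀ e, rev (rev e) = e
  rev_ne : ∀ e, rev e ≠ e
  tail_rev : ∀ e, tail (rev e) = head e
  head_rev : ∀ e, head (rev e) = tail e
  no_loop : ∀ e, tail e ≠ head e
  u : E → ℝ≥0∞

namespace FlowInstance

variable {V E : Type} [Fintype V] [Fintype E] [DecidableEq V]

/-- The excess of a node: total inflow minus total outflow. -/
def excess (I : FlowInstance V E) (f : E → ℝ) (i : V) : ℝ :=
  ∑ e ∈ Finset.univ.filter (fun e => I.head e = i), f e -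
    ∑ e ∈ Finset.univ.filter (fun e => I.tail e = i), f e

/-- A feasible flow: nonnegative, within capacities, and conserving at every
node other than `s` and `t`. -/
def Feasible (I : FlowInstance V E) (f : E → ℝ) : Prop :=
  (∀ e, 0 ≤ f e) ∧ (∀ e, ENNReal.ofReal (f e) ≤ I.u e) ∧
    ∀ i, i ≠ I.s → i ≠ I.t → I.excess f i = 0

/-- The value of a flow. -/
def val (I : FlowInstance V E) (f : E → ℝ) : ℝ := -I.excess f I.s

/-- The set of values of feasible flows. -/
def flowValues (I : FlowInstance V E) : Set ℝ := {x | ∃ f, I.Feasible f ∧ I.val f = x}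

/-- The maximum flow value `ν(G,u)` (as a real supremum). -/
def maxFlowVal (I : FlowInstance V E) : ℝ := sSup I.flowValues

/-- The instance is bounded if `ν(G,u) < ∞`. -/
def Bounded (I : FlowInstance V E) : Prop := BddAbove I.flowValues

/-- Residual capacities `u^f_e = u_e - f_e + f_{rev e}` of a flow. -/
def residual (I : FlowInstance V E) (f : E → ℝ) : E → ℝ≥0∞ :=
  fun e => I.u e - ENNReal.ofReal (f e) + ENNReal.ofReal (f (I.rev e))

/-- The instance on the same graph with capacities replaced by `u'`. -/
def withCapacity (I : FlowInstance V E) (u' : E → ℝ≥0∞) : FlowInstance V E :=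
  { I with u := u' }

/-- An `s`–`t` cut. -/
def IsCut (I : FlowInstance V E) (S : Finset V) : Prop := I.s ∈ S ∧ I.t ∉ S

/-- The capacity `u(S, V∖S)` of a cut. -/
def cutCap (I : FlowInstance V E) (S : Finset V) : ℝ≥0∞ :=
  ∑ e ∈ Finset.univ.filter (fun e => I.tail e ∈ S ∧ I.head e ∉ S), I.u e

/-- The total residual capacity `u^f(S, V∖S)` of a cut. -/
def resCutCap (I : FlowInstance V E) (f : E → ℝ) (S : Finset V) : ℝ≥0∞ :=
  ∑ e ∈ Finset.univ.filter (fun e => I.tail e ∈ S ∧ I.head e ∉ S), I.residual f e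

/-- A directed path from `x` to `y` through pairwise distinct nodes using only
arcs from `A`. -/
def IsDiPath (I : FlowInstance V E) (A : Set E) (x y : V) : Prop :=
  ∃ (k : ℕ) (v : Fin (k + 1) → V) (es : Fin k → E),
    v 0 = x ∧ v (Fin.last k) = y ∧ Function.Injective v ∧
    ∀ i : Fin k, es i ∈ A ∧ I.tail (es i) = v i.castSucc ∧ I.head (es i) = v i.succ

/-- `A` contains a directed cycle: a head-to-tail sequence of arcs of `A` through
pairwise distinct nodes returning to its starting node. -/
def HasDiCycle (I : FlowInstance V E) (A : Set E) : Prop :=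
  ∃ (k : ℕ) (v : Fin (k + 1) → V) (es : Fin (k + 1) → E),
    Function.Injective v ∧
    ∀ i : Fin (k + 1), es i ∈ A ∧ I.tail (es i) = v i ∧ I.head (es i) = v (i + 1)

/-- The constant `Γ = 4 n²` where `n = |V|`. -/
def Gamma (I : FlowInstance V E) : ℝ := 4 * (Fintype.card V : ℝ) ^ 2

end FlowInstance

/-- `I'` extends `I`: same node set, same `s` and `t`, the arc set of `I'` contains
that of `I` (via the injection `ι`), with the same endpoints, capacities and
reversal involution on the arcs of `I`. -/
def IsExtension {V E E' : Type} [Fintype V] [Fintype E] [Fintype E'] [DecidableEq V]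
    (I : FlowInstance V E) (I' : FlowInstance V E') (ι : E → E') : Prop :=
  Function.Injective ι ∧ I'.s = I.s ∧ I'.t = I.t ∧
    (∀ e, I'.tail (ι e) = I.tail e) ∧ (∀ e, I'.head (ι e) = I.head e) ∧
    (∀ e, I'.rev (ι e) = ι (I.rev e)) ∧ (∀ e, I'.u (ι e) = I.u e)

namespace FlowInstance

variable {V E : Type} [Fintype V] [Fintype E] [DecidableEq V]

lemma excess_eq_sum (I : FlowInstance V E) (f : E → ℝ) (i : V) :
    I.excess f i =
      ∑ e, f e * ((if I.head e = i then 1 else 0) - (if I.tail e = i then 1 else 0)) := by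
  simp [excess, Finset.sum_filter, mul_sub, Finset.sum_sub_distrib]

lemma excess_zero (I : FlowInstance V E) (i : V) : I.excess 0 i = 0 := by
  simp [excess]

lemma excess_add (I : FlowInstance V E) (f g : E → ℝ) (i : V) :
    I.excess (f + g) i = I.excess f i + I.excess g i := by
  simp [excess_eq_sum, add_mul, Finset.sum_add_distrib]

lemma excess_smul (I : FlowInstance V E) (c : ℝ) (f : E → ℝ) (i : V) :
    I.excess (c • f) i = c * I.excess f i := by
  simp [excess_eq_sum, mul_assoc, Finset.mul_sum]

lemma excess_single (I : FlowInstance V E) (e : E) (i : V) :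
    I.excess (Pi.single e 1) i =
      (if I.head e = i then 1 else 0) - (if I.tail e = i then 1 else 0) := by
  rw [excess_eq_sum, Finset.sum_eq_single e]
  · simp
  · intro b _ hb
    simp [Pi.single_eq_of_ne hb]
  · simp

lemma sum_excess (I : FlowInstance V E) (f : E → ℝ) (S : Finset V) :
    ∑ i ∈ S, I.excess f i =
      ∑ e, f e * ((if I.head e ∈ S then 1 else 0) - (if I.tail e ∈ S then 1 else 0)) := by
  simp_rw [excess_eq_sum]
  rw [Finset.sum_comm]
  refine Finset.sum_congr rfl fun e _ => ?_
  rw [← Finset.mul_sum, Finset.sum_sub_distrib]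
  simp

/-- The arcs strictly between their bounds. -/
def freeArcs (I : FlowInstance V E) (f : E → ℝ) : Set E :=
  {e | 0 < f e ∧ ENNReal.ofReal (f e) < I.u e}

/-- Adjacency along an arc of `A`, with `s` and `t` also considered adjacent. -/
def Link (I : FlowInstance V E) (A : Set E) (x y : V) : Prop :=
  (∃ a ∈ A, I.tail a = x ∧ I.head a = y) ∨ (x = I.s ∧ y = I.t)

lemma exists_flow_of_eqvGen_link (I : FlowInstance V E) {A : Set E} {x y : V}
    (h : Relation.EqvGen (I.Link A) x y) :
    ∃ g : E → ℝ, (∀ a, a ∉ A → g a = 0) ∧ ∀ i, i ≠ I.s → i ≠ I.t →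
      I.excess g i = (if y = i then 1 else 0) - (if x = i then 1 else 0) := by
  induction h with
  | rel x y h =>
    rcases h with ⟨a, ha, rfl, rfl⟩ | ⟨rfl, rfl⟩
    · refine ⟨Pi.single a 1, fun b hb => ?_, fun i _ _ => I.excess_single a i⟩
      exact Pi.single_eq_of_ne (fun h : b = a => hb (h ▸ ha)) _
    · refine ⟨0, fun _ _ => rfl, fun i hs ht => ?_⟩
      simp [excess_zero, hs.symm, ht.symm]
  | refl x => exact ⟨0, fun _ _ => rfl, fun i _ _ => by simp [excess_zero]⟩
  | symm x y _ ih =>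
    obtain ⟨g, hg, hgi⟩ := ih
    refine ⟨(-1 : ℝ) • g, fun a ha => by simp [hg a ha], fun i hs ht => ?_⟩
    rw [excess_smul, hgi i hs ht]
    ring
  | trans x y z _ _ ih₁ ih₂ =>
    obtain ⟨g, hg, hgi⟩ := ih₁
    obtain ⟨k, hk, hki⟩ := ih₂
    refine ⟨g + k, fun a ha => by simp [hg a ha, hk a ha], fun i hs ht => ?_⟩
    rw [excess_add, hgi i hs ht, hki i hs ht]
    ring

/-- A basic flow admits no nonzero perturbation on its free arcs that preserves conservation. -/
lemma eq_zero_of_mem_extremePoints (I : FlowInstance V E) {f : E → ℝ}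
    (hf : f ∈ Set.extremePoints ℝ {g : E → ℝ | I.Feasible g}) {g : E → ℝ}
    (hg : ∀ a, a ∉ I.freeArcs f → g a = 0)
    (hgi : ∀ i, i ≠ I.s → i ≠ I.t → I.excess g i = 0) : g = 0 := by
  obtain ⟨h0, hu, hc⟩ := hf.1
  have hfeas : ∀ᶠ ε : ℝ in nhds 0, I.Feasible (f + ε • g) := by
    have hbounds : ∀ᶠ ε : ℝ in nhds 0, ∀ a,
        0 ≤ f a + ε * g a ∧ ENNReal.ofReal (f a + ε * g a) ≤ I.u a := by
      refine Filter.eventually_all.2 fun a => ?_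
      by_cases ha : a ∈ I.freeArcs f
      · have hcont : Continuous fun ε : ℝ => f a + ε * g a := by fun_prop
        have h₁ : ∀ᶠ ε : ℝ in nhds 0, 0 < f a + ε * g a :=
          hcont.continuousAt.eventually_const_lt (by simpa using ha.1)
        have h₂ : ∀ᶠ ε : ℝ in nhds 0, ENNReal.ofReal (f a + ε * g a) < I.u a :=
          (ENNReal.continuous_ofReal.comp hcont).continuousAt.eventually_lt_const
            (by simpa using ha.2)
        filter_upwards [h₁, h₂] with ε h₁ h₂ using ⟨h₁.le, h₂.le⟩
      · simp [hg a ha, h0 a, hu a]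
    filter_upwards [hbounds] with ε hε
    refine ⟨fun a => (hε a).1, fun a => (hε a).2, fun i hs ht => ?_⟩
    rw [excess_add, excess_smul, hc i hs ht, hgi i hs ht]
    simp
  have hneg : ∀ᶠ ε : ℝ in nhds 0, I.Feasible (f + (-ε) • g) := by
    have : Filter.Tendsto (fun ε : ℝ => -ε) (nhds 0) (nhds 0) := by
      simpa using (continuous_neg (G := ℝ)).tendsto 0
    exact this.eventually hfeas
  obtain ⟨ε, ⟨h₁, h₂⟩, hε⟩ :=
    (((hfeas.and hneg).filter_mono (nhdsWithin_le_nhds (s := {0}ᶜ))).and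
      self_mem_nhdsWithin).exists
  have hseg : f ∈ openSegment ℝ (f + ε • g) (f + (-ε) • g) := by
    refine ⟨1 / 2, 1 / 2, by norm_num, by norm_num, by norm_num, ?_⟩
    module
  have heq : f + ε • g = f := hf.2 h₁ h₂ hseg
  have : ε • g = 0 := by simpa using heq
  exact (smul_eq_zero.1 this).resolve_left hε

/-- Every free arc of a basic flow is the only free arc crossing some node set avoiding the
source and the sink. -/
lemma exists_cut_of_mem_freeArcs (I : FlowInstance V E) {f : E → ℝ}
    (hf : f ∈ Set.extremePoints ℝ {g : E → ℝ | I.Feasible g}) {e : E}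
    (he : e ∈ I.freeArcs f) :
    ∃ S : Finset V, I.s ∉ S ∧ I.t ∉ S ∧ ¬(I.tail e ∈ S ↔ I.head e ∈ S) ∧
      ∀ a ∈ I.freeArcs f, a ≠ e → (I.tail a ∈ S ↔ I.head a ∈ S) := by
  set R := Relation.EqvGen (I.Link (I.freeArcs f \ {e}))
  have hnot : ¬R (I.head e) (I.tail e) := by
    intro h
    obtain ⟨g, hg, hgi⟩ := I.exists_flow_of_eqvGen_link h
    have hge : g e = 0 := hg e (by simp)
    have hzero := I.eq_zero_of_mem_extremePoints hf (g := Pi.single e 1 + g)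
      (fun a ha => by
        have hae : a ≠ e := fun h => ha (h ▸ he)
        simp [Pi.single_eq_of_ne hae, hg a fun h => ha h.1])
      (fun i hs ht => by
        rw [excess_add, excess_single, hgi i hs ht]
        ring)
    have := congrFun hzero e
    simp [hge] at this
  have hst : R I.s I.t := .rel _ _ (.inr ⟨rfl, rfl⟩)
  have harc : ∀ a ∈ I.freeArcs f, a ≠ e → R (I.tail a) (I.head a) := fun a ha hae =>
    .rel _ _ (.inl ⟨a, ⟨ha, hae⟩, rfl, rfl⟩)
  have hsymm : ∀ {x y}, R x y → R y x := fun h => .symm _ _ h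
  have htrans : ∀ {x y z}, R x y → R y z → R x z := fun h h' => .trans _ _ _ h h'
  have hclass : ∀ x, ¬R x I.s → (¬(R x (I.tail e) ↔ R x (I.head e))) →
      ∃ S : Finset V, I.s ∉ S ∧ I.t ∉ S ∧ ¬(I.tail e ∈ S ↔ I.head e ∈ S) ∧
        ∀ a ∈ I.freeArcs f, a ≠ e → (I.tail a ∈ S ↔ I.head a ∈ S) := by
    intro x hx hxe
    refine ⟨Finset.univ.filter (R x), by simpa using hx, ?_, by simpa using hxe, ?_⟩
    · simpa using fun h => hx (htrans h (hsymm hst))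
    · intro a ha hae
      simpa using ⟨fun h => htrans h (harc a ha hae), fun h => htrans h (hsymm (harc a ha hae))⟩
  by_cases hs : R (I.head e) I.s
  · refine hclass (I.tail e) (fun h => hnot (htrans hs (hsymm h))) fun h => ?_
    exact hnot (hsymm (h.1 (.refl _)))
  · exact hclass (I.head e) hs fun h => hnot (h.2 (.refl _))

end FlowInstance

/-- For a basic (extreme point) flow with acyclic support, every flow value is a
`{-1,0,1}`-combination of the finite capacities. -/
theorem basic_acyclic_flow_pm_combination
    {V E : Type} [Fintype V] [Fintype E] [DecidableEq V]
    (I : FlowInstance V E)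
    (f : E → ℝ) (hf : f ∈ Set.extremePoints ℝ {g : E → ℝ | I.Feasible g})
    (hcyc : ¬ I.HasDiCycle {e | f e ≠ 0}) :
    ∀ e : E, ∃ χ : E → ℝ,
      (∀ e', χ e' = -1 ∨ χ e' = 0 ∨ χ e' = 1) ∧
      (∀ e', I.u e' = ⊤ → χ e' = 0) ∧
      f e = ∑ e' ∈ Finset.univ.filter (fun e' => I.u e' ≠ ⊤), χ e' * (I.u e').toReal := by

  intro e
  obtain ⟨h0, hu, hc⟩ := hf.1
  have hval : ∀ a, ENNReal.ofReal (f a) = I.u a → I.u a ≠ ⊤ ∧ (I.u a).toReal = f a := by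
    intro a ha
    rw [← ha]
    exact ⟨ENNReal.ofReal_ne_top, ENNReal.toReal_ofReal (h0 a)⟩
  by_cases he : e ∈ I.freeArcs f
  · obtain ⟨S, hs, ht, hS, hfree⟩ := I.exists_cut_of_mem_freeArcs hf he
    set d : E → ℝ := fun a =>
      (if I.head a ∈ S then 1 else 0) - (if I.tail a ∈ S then 1 else 0) with hd
    have hsum : ∑ a, f a * d a = 0 := by
      rw [← I.sum_excess f S]
      exact Finset.sum_eq_zero fun i hi =>
        hc i (fun h => hs (h ▸ hi)) (fun h => ht (h ▸ hi))
    have hd_val : ∀ a, d a = -1 ∨ d a = 0 ∨ d a = 1 := by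
      intro a
      simp only [hd]
      split_ifs <;> norm_num
    have hde : d e = -1 ∨ d e = 1 := by
      simp only [hd]
      split_ifs <;> simp_all
    have hde_sq : d e * d e = 1 := by
      rcases hde with h | h <;> rw [h] <;> norm_num
    refine ⟨fun a => if ENNReal.ofReal (f a) = I.u a then -(d e) * d a else 0, ?_, ?_, ?_⟩
    · intro a
      dsimp only
      split_ifs
      · rcases hde with h | h <;> rcases hd_val a with h' | h' | h' <;> rw [h, h'] <;> norm_num
      · simp
    · intro a ha
      exact if_neg fun h => (hval a h).1 ha
    · have hterm : ∀ a, (if I.u a ≠ ⊤ then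
          (if ENNReal.ofReal (f a) = I.u a then -(d e) * d a else 0) * (I.u a).toReal else 0) =
          (if a = e then f e else 0) - d e * (f a * d a) := by
        intro a
        by_cases hsat : ENNReal.ofReal (f a) = I.u a
        · have hae : a ≠ e := by
            rintro rfl
            exact he.2.ne hsat
          rw [if_pos (hval a hsat).1, if_pos hsat, if_neg hae, (hval a hsat).2]
          ring
        · rw [if_neg hsat, zero_mul, ite_self]
          by_cases hae : a = e
          · subst hae
            rw [if_pos rfl]
            linear_combination f a * hde_sq
          · rw [if_neg hae]
            rcases (h0 a).eq_or_lt with hz | hpos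
            · simp [← hz]
            · have hda : d a = 0 := by
                simp [hd, hfree a ⟨hpos, lt_of_le_of_ne (hu a) hsat⟩ hae]
              simp [hda]
      rw [Finset.sum_filter, Finset.sum_congr rfl fun a _ => hterm a, Finset.sum_sub_distrib,
        ← Finset.mul_sum, hsum]
      simp
  · rcases (h0 e).eq_or_lt with hz | hpos
    · exact ⟨0, fun _ => by simp, fun _ _ => rfl, by simp [← hz]⟩
    · have hsat : ENNReal.ofReal (f e) = I.u e :=
        (hu e).eq_of_not_lt fun h => he ⟨hpos, h⟩
      refine ⟨Pi.single e 1, fun a => ?_, fun a ha => ?_, ?_⟩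
      · by_cases h : a = e
        · subst h; simp
        · simp [Pi.single_eq_of_ne h]
      · exact Pi.single_eq_of_ne (fun h : a = e => (hval e hsat).1 (h ▸ ha)) _
      · rw [Finset.sum_eq_single e]
        · simp [(hval e hsat).2]
        · intro b _ hb
          simp [Pi.single_eq_of_ne hb]
        · intro h
          exact absurd (by simpa using (hval e hsat).1) h
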